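/- Let u be a positive integer and write u = ∏_p p^{l_p} with l_p = v_p(u) the p-adic valuation. Let χ be a Dirichlet character modulo a positive integer r₁. Then for every complex z with Re z > 1, the Dirichlet series Σ_{n=1}^∞ a(u n) χ(n) n^{−z} converges absolutely and equals the product ∏_{p ∤ u} (Σ_{α=0}^∞ a(p^α) χ(p^α) p^{−αz}) · ∏_{p ∣ u} (Σ_{α=0}^∞ a(p^{l_p + α}) χ(p^α) p^{−αz}), where all the inner series converge absolutely and the products over primes converge. -/

import Mathlib

/-- `abelianCount n` is the number of isomorphism classes of abelian groups of order `n`: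
the multiplicative function with `abelianCount (p^α) = P(α)`, the number of partitions of `α`. -/
def abelianCount (n : ℕ) : ℕ :=
  n.factorization.prod fun _ α => Fintype.card (Nat.Partition α)

open Finset in
lemma card_partition_bounded_le {x : ℝ} (hx0 : 0 < x) (hx1 : x < 1) (k n : ℕ) :
    ((univ.filter fun π : n.Partition => ∀ i ∈ π.parts, i ≤ k).card : ℝ) * x ^ n ≤
      Real.exp (∑ j ∈ range k, x ^ (j + 1) / (1 - x)) := by
  induction k generalizing n with
  | zero =>
    have h1 : (univ.filter fun π : n.Partition => ∀ i ∈ π.parts, i ≤ 0).card ≤ 1 := by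
      rw [card_le_one]
      have key : ∀ π ∈ univ.filter fun π : n.Partition => ∀ i ∈ π.parts, i ≤ 0, π.parts = 0 := by
        intro π hπ
        rw [mem_filter] at hπ
        refine Multiset.eq_zero_of_forall_notMem fun i hi => ?_
        have := π.parts_pos hi
        have := hπ.2 i hi
        omega
      intro π hπ τ hτ
      exact Nat.Partition.ext ((key π hπ).trans (key τ hτ).symm)
    simp only [range_zero, sum_empty, Real.exp_zero]
    exact mul_le_one₀ (by exact_mod_cast h1) (by positivity) (pow_le_one₀ hx0.le hx1.le)
  | succ k ih =>
    set C := Real.exp (∑ j ∈ range k, x ^ (j + 1) / (1 - x)) with hC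
    set a := x ^ (k + 1) / (1 - x) with ha
    have hC0 : 0 < C := Real.exp_pos _
    have hstep : C + x ^ (k + 1) * (C * Real.exp a) ≤ C * Real.exp a := by
      have h1 : 1 + a ≤ Real.exp a := by linarith [Real.add_one_le_exp a]
      have hy : x ^ (k + 1) ≤ x := pow_le_of_le_one hx0.le hx1.le (by omega)
      have hy0 : 0 < x ^ (k + 1) := by positivity
      have hpos : 0 < 1 - x := by linarith
      have h2 : 1 ≤ (1 + a) * (1 - x ^ (k + 1)) := by
        have h3 : (1 + a) * (1 - x ^ (k + 1)) - 1 =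
            x ^ (k + 1) * (x - x ^ (k + 1)) / (1 - x) := by
          rw [ha]; field_simp; ring
        have : 0 ≤ x ^ (k + 1) * (x - x ^ (k + 1)) / (1 - x) :=
          div_nonneg (mul_nonneg hy0.le (by linarith)) hpos.le
        linarith
      have h4 : 1 ≤ Real.exp a * (1 - x ^ (k + 1)) :=
        h2.trans (mul_le_mul_of_nonneg_right h1 (by linarith))
      nlinarith
    rw [sum_range_succ, Real.exp_add, ← hC]
    induction n using Nat.strong_induction_on with
    | _ n ihn =>
      have hsub : (univ.filter fun π : n.Partition => ∀ i ∈ π.parts, i ≤ k + 1) ⊆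
          (univ.filter fun π : n.Partition => ∀ i ∈ π.parts, i ≤ k) ∪
          (univ.filter fun π : n.Partition => (∀ i ∈ π.parts, i ≤ k + 1) ∧ k + 1 ∈ π.parts) := by
        intro π hπ
        simp only [mem_union, mem_filter, mem_univ, true_and] at hπ ⊢
        by_cases h : k + 1 ∈ π.parts
        · exact Or.inr ⟨hπ, h⟩
        · refine Or.inl fun i hi => ?_
          have : i ≠ k + 1 := fun hik => h (hik ▸ hi)
          have := hπ i hi
          omega
      have hcard := (card_le_card hsub).trans (card_union_le _ _)
      have hlast : ((univ.filter fun π : n.Partition =>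
          (∀ i ∈ π.parts, i ≤ k + 1) ∧ k + 1 ∈ π.parts).card : ℝ) * x ^ n ≤
          x ^ (k + 1) * (C * Real.exp a) := by
        by_cases hn : k + 1 ≤ n
        · obtain ⟨m, rfl⟩ := Nat.exists_eq_add_of_le' hn
          let F : m.Partition → (m + (k + 1)).Partition := fun τ =>
            { parts := (k + 1) ::ₘ τ.parts
              parts_pos := by
                intro i hi
                rcases Multiset.mem_cons.1 hi with rfl | h
                · omega
                · exact τ.parts_pos h
              parts_sum := by rw [Multiset.sum_cons, τ.parts_sum]; omega }
          have himg : (univ.filter fun π : (m + (k + 1)).Partition =>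
              (∀ i ∈ π.parts, i ≤ k + 1) ∧ k + 1 ∈ π.parts) ⊆
              (univ.filter fun τ : m.Partition => ∀ i ∈ τ.parts, i ≤ k + 1).image F := by
            intro π hπ
            simp only [mem_filter, mem_univ, true_and, mem_image] at hπ ⊢
            have hc := Multiset.cons_erase hπ.2
            refine ⟨⟨π.parts.erase (k + 1), fun hi => π.parts_pos (Multiset.mem_of_mem_erase hi),
              ?_⟩, fun i hi => hπ.1 i (Multiset.mem_of_mem_erase hi), Nat.Partition.ext hc⟩
            have := π.parts_sum
            rw [← hc, Multiset.sum_cons] at this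
            omega
          have hle := (card_le_card himg).trans card_image_le
          have hm := ihn m (by omega)
          calc _ ≤ ((univ.filter fun τ : m.Partition => ∀ i ∈ τ.parts, i ≤ k + 1).card : ℝ)
                * x ^ (m + (k + 1)) := by gcongr
            _ = x ^ (k + 1) *
                (((univ.filter fun τ : m.Partition => ∀ i ∈ τ.parts, i ≤ k + 1).card : ℝ)
                * x ^ m) := by ring
            _ ≤ _ := by gcongr
        · have h0 : (univ.filter fun π : n.Partition =>
              (∀ i ∈ π.parts, i ≤ k + 1) ∧ k + 1 ∈ π.parts) = ∅ := by
            refine filter_eq_empty_iff.2 fun π _ h => hn ?_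
            have := Multiset.single_le_sum (fun y _ => Nat.zero_le y) _ h.2
            rwa [π.parts_sum] at this
          rw [h0]
          simp only [card_empty, Nat.cast_zero, zero_mul]
          positivity
      calc _ ≤ (((univ.filter fun π : n.Partition => ∀ i ∈ π.parts, i ≤ k).card +
            (univ.filter fun π : n.Partition =>
              (∀ i ∈ π.parts, i ≤ k + 1) ∧ k + 1 ∈ π.parts).card : ℕ) : ℝ) * x ^ n := by
            gcongr
        _ ≤ C + x ^ (k + 1) * (C * Real.exp a) := by
            rw [Nat.cast_add, add_mul]
            exact add_le_add (ih n) hlast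
        _ ≤ _ := hstep

/-- The partition function grows more slowly than any exponential. -/
lemma exists_card_partition_le {r : ℝ} (hr : 1 < r) :
    ∃ K : ℝ, 1 ≤ K ∧ ∀ n : ℕ, (Fintype.card n.Partition : ℝ) ≤ K * r ^ n := by
  set x := r⁻¹ with hx
  have hx0 : 0 < x := by positivity
  have hx1 : x < 1 := inv_lt_one_of_one_lt₀ hr
  have hpos : 0 < 1 - x := by linarith
  refine ⟨Real.exp ((1 - x)⁻¹ / (1 - x)), Real.one_le_exp (by positivity), fun n => ?_⟩
  have h := card_partition_bounded_le hx0 hx1 n n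
  have hall : (Finset.univ.filter fun π : n.Partition => ∀ i ∈ π.parts, i ≤ n) = Finset.univ := by
    refine Finset.filter_true_of_mem fun π _ i hi => ?_
    have := Multiset.single_le_sum (fun y _ => Nat.zero_le y) _ hi
    rwa [π.parts_sum] at this
  rw [hall, Finset.card_univ] at h
  have hsum : ∑ j ∈ Finset.range n, x ^ (j + 1) / (1 - x) ≤ (1 - x)⁻¹ / (1 - x) := by
    rw [← Finset.sum_div]
    gcongr
    calc ∑ j ∈ Finset.range n, x ^ (j + 1) ≤ ∑ j ∈ Finset.range n, x ^ j :=
          Finset.sum_le_sum fun j _ => pow_le_pow_of_le_one hx0.le hx1.le (Nat.le_succ j)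
      _ ≤ ∑' j, x ^ j := (summable_geometric_of_lt_one hx0.le hx1).sum_le_tsum _
          fun j _ => by positivity
      _ = _ := tsum_geometric_of_lt_one hx0.le hx1
  have h' := h.trans (Real.exp_le_exp.2 hsum)
  rw [hx, inv_pow, ← div_eq_mul_inv, div_le_iff₀ (by positivity)] at h'
  exact h'

lemma abelianCount_eq_prod {n : ℕ} {s : Finset ℕ} (hs : n.primeFactors ⊆ s) :
    abelianCount n = ∏ p ∈ s, Fintype.card (Nat.Partition (n.factorization p)) :=
  Finsupp.prod_of_support_subset _ (by simpa using hs) _ fun _ _ => by simp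

lemma abelianCount_pos (n : ℕ) : 0 < abelianCount n :=
  abelianCount_eq_prod (n := n) subset_rfl ▸ Finset.prod_pos fun _ _ => Fintype.card_pos

lemma abelianCount_one : abelianCount 1 = 1 := by simp [abelianCount]

lemma abelianCount_prime_pow {p : ℕ} (hp : p.Prime) (k : ℕ) :
    abelianCount (p ^ k) = Fintype.card (Nat.Partition k) := by
  rw [abelianCount, hp.factorization_pow, Finsupp.prod_single_index (by simp)]

lemma abelianCount_mul_of_coprime {m n : ℕ} (h : m.Coprime n) :
    abelianCount (m * n) = abelianCount m * abelianCount n := by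
  rw [abelianCount, Nat.factorization_mul_of_coprime h]
  exact Finsupp.prod_add_index_of_disjoint (by simpa using h.disjoint_primeFactors) _

/-- The function `n ↦ a (u n) / a u` is multiplicative, stated without division. -/
lemma abelianCount_mul_mul_of_coprime {u m n : ℕ} (hu : u ≠ 0) (hm : m ≠ 0) (hn : n ≠ 0)
    (h : m.Coprime n) :
    abelianCount (u * (m * n)) * abelianCount u = abelianCount (u * m) * abelianCount (u * n) := by
  have hne : u * (m * n) ≠ 0 := by positivity
  have hs (d : ℕ) (hd : d ∣ u * (m * n)) : d.primeFactors ⊆ (u * (m * n)).primeFactors :=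
    Nat.primeFactors_mono hd hne
  rw [abelianCount_eq_prod (hs _ dvd_rfl), abelianCount_eq_prod (hs u (dvd_mul_right _ _)),
    abelianCount_eq_prod (hs (u * m) ⟨n, by ring⟩), abelianCount_eq_prod (hs (u * n) ⟨m, by ring⟩),
    ← Finset.prod_mul_distrib, ← Finset.prod_mul_distrib]
  refine Finset.prod_congr rfl fun p hp => ?_
  have e1 : (u * (m * n)).factorization p =
      u.factorization p + (m.factorization p + n.factorization p) := by
    rw [Nat.factorization_mul hu (by positivity), Nat.factorization_mul hm hn]
    rfl
  have e2 : (u * m).factorization p = u.factorization p + m.factorization p := by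
    rw [Nat.factorization_mul hu hm]
    rfl
  have e3 : (u * n).factorization p = u.factorization p + n.factorization p := by
    rw [Nat.factorization_mul hu hn]
    rfl
  rw [e1, e2, e3]
  have hp' := Nat.prime_of_mem_primeFactors hp
  by_cases hpm : p ∣ m
  · rw [Nat.factorization_eq_zero_of_not_dvd (n := n)
      fun hpn => hp'.one_lt.ne' (Nat.eq_one_of_dvd_coprimes h hpm hpn)]
    simp
  · rw [Nat.factorization_eq_zero_of_not_dvd hpm]
    simp [mul_comm]

lemma abelianCount_mul_prime_pow {u p : ℕ} (hu : u ≠ 0) (hp : p.Prime) (k : ℕ) :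
    abelianCount (u * p ^ k) * abelianCount (p ^ u.factorization p) =
      abelianCount u * abelianCount (p ^ (u.factorization p + k)) := by
  have hc (j : ℕ) : (p ^ j).Coprime (u / p ^ u.factorization p) :=
    (Nat.coprime_ordCompl hp hu).pow_left j
  have h1 := Nat.ordProj_mul_ordCompl_eq_self u p
  have h2 : u * p ^ k = p ^ (u.factorization p + k) * (u / p ^ u.factorization p) := by
    conv_lhs => rw [← h1]
    ring
  have h3 : abelianCount u =
      abelianCount (p ^ u.factorization p) * abelianCount (u / p ^ u.factorization p) := by
    conv_lhs => rw [← h1]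
    exact abelianCount_mul_of_coprime (hc _)
  rw [h2, abelianCount_mul_of_coprime (hc _), h3]
  ring

lemma exists_abelianCount_le_rpow {ε : ℝ} (hε : 0 < ε) :
    ∃ D : ℝ, 0 < D ∧ ∀ n : ℕ, n ≠ 0 → (abelianCount n : ℝ) ≤ D * (n : ℝ) ^ ε := by
  have hr : 1 < (2 : ℝ) ^ ε := Real.one_lt_rpow one_lt_two hε
  obtain ⟨K, hK, hP⟩ := exists_card_partition_le hr
  obtain ⟨N, hN⟩ := Filter.eventually_atTop.1
    (((tendsto_rpow_atTop hε).comp tendsto_natCast_atTop_atTop).eventually_ge_atTop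
      (K * (2 : ℝ) ^ ε))
  refine ⟨K ^ N, by positivity, fun n hn => ?_⟩
  have hfac (p : ℕ) (hp : p ∈ n.primeFactors) :
      (Fintype.card (Nat.Partition (n.factorization p)) : ℝ) ≤
        (if p < N then K else 1) * ((p : ℝ) ^ ε) ^ n.factorization p := by
    have hp' := Nat.prime_of_mem_primeFactors hp
    refine (hP _).trans ?_
    split_ifs with hpN
    · have : (2 : ℝ) ≤ p := by exact_mod_cast hp'.two_le
      gcongr
    · have h1 : K * (2 : ℝ) ^ ε ≤ (p : ℝ) ^ ε := hN p (not_lt.1 hpN)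
      have h0 : n.factorization p ≠ 0 :=
        (hp'.factorization_pos_of_dvd hn (Nat.dvd_of_mem_primeFactors hp)).ne'
      calc K * ((2 : ℝ) ^ ε) ^ n.factorization p
          ≤ K ^ n.factorization p * ((2 : ℝ) ^ ε) ^ n.factorization p := by
            gcongr
            exact le_self_pow₀ hK h0
        _ = (K * (2 : ℝ) ^ ε) ^ n.factorization p := (mul_pow _ _ _).symm
        _ ≤ ((p : ℝ) ^ ε) ^ n.factorization p := by gcongr
        _ = _ := (one_mul _).symm
  have hn' : (n : ℝ) ^ ε = ∏ p ∈ n.primeFactors, ((p : ℝ) ^ ε) ^ n.factorization p := by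
    have h : (n : ℝ) = ∏ p ∈ n.primeFactors, (p : ℝ) ^ n.factorization p := by
      conv_lhs => rw [← Nat.prod_factorization_pow_eq_self hn]
      simp [Finsupp.prod]
    conv_lhs => rw [h]
    rw [← Real.finsetProd_rpow _ _ fun _ _ => by positivity]
    refine Finset.prod_congr rfl fun p _ => ?_
    exact (Real.rpow_pow_comm (Nat.cast_nonneg p) _ _).symm
  rw [abelianCount_eq_prod subset_rfl, Nat.cast_prod]
  refine (Finset.prod_le_prod (fun _ _ => by positivity) hfac).trans ?_
  rw [Finset.prod_mul_distrib, ← hn']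
  gcongr
  rw [Finset.prod_ite, Finset.prod_const, Finset.prod_const_one, mul_one]
  refine pow_le_pow_right₀ hK ?_
  calc _ ≤ (Finset.range N).card := Finset.card_le_card fun p hp =>
        Finset.mem_range.2 (Finset.mem_filter.1 hp).2
    _ = N := Finset.card_range N

lemma summable_norm_abelianCount_twisted {u : ℕ} (hu : 0 < u) {r : ℕ}
    (χ : DirichletCharacter ℂ r) {z : ℂ} (hz : 1 < z.re) :
    Summable fun n : ℕ =>
      ‖(abelianCount (u * n) : ℂ) * χ (n : ZMod r) * (n : ℂ) ^ (-z)‖ := by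
  set ε := (z.re - 1) / 2 with hε
  obtain ⟨D, hD, hle⟩ := exists_abelianCount_le_rpow (show 0 < ε by rw [hε]; linarith)
  refine Summable.of_nonneg_of_le (fun _ => norm_nonneg _) (fun n => ?_)
    ((Real.summable_nat_rpow.2 (show ε - z.re < -1 by rw [hε]; linarith)).mul_left
      (D * (u : ℝ) ^ ε))
  rcases Nat.eq_zero_or_pos n with rfl | hn
  · have : -z ≠ 0 := fun h => by
      have : z = 0 := neg_eq_zero.1 h
      norm_num [this] at hz
    rw [Nat.cast_zero (R := ℂ), Complex.zero_cpow this, mul_zero, norm_zero]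
    positivity
  · rw [norm_mul, norm_mul, Complex.norm_natCast, Complex.norm_natCast_cpow_of_pos hn]
    have hn' : (0 : ℝ) < n := by exact_mod_cast hn
    calc (abelianCount (u * n) : ℝ) * ‖χ (n : ZMod r)‖ * (n : ℝ) ^ (-z).re
        ≤ (D * ((u * n : ℕ) : ℝ) ^ ε) * 1 * (n : ℝ) ^ (-z).re := by
          gcongr
          · exact hle _ (by positivity)
          · exact χ.norm_le_one _
      _ = D * (u : ℝ) ^ ε * (n : ℝ) ^ (ε - z.re) := by
          rw [Nat.cast_mul, Real.mul_rpow (by positivity) (by positivity), Complex.neg_re,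
            sub_eq_add_neg, Real.rpow_add hn']
          ring

lemma natCast_pow_cpow_neg (p k : ℕ) (z : ℂ) :
    ((p ^ k : ℕ) : ℂ) ^ (-z) = (p : ℂ) ^ (-(k : ℂ) * z) := by
  rw [Nat.cast_pow, ← Complex.natCast_cpow_natCast_mul, neg_mul, mul_neg]

lemma abelianCount_twisted_prime_pow {u : ℕ} (hu : u ≠ 0) {r : ℕ} (χ : DirichletCharacter ℂ r)
    (z : ℂ) {p : ℕ} (hp : p.Prime) (k : ℕ) :
    (abelianCount (u * p ^ k) : ℂ) * χ ((p ^ k : ℕ) : ZMod r) * ((p ^ k : ℕ) : ℂ) ^ (-z) =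
      (abelianCount u : ℂ) / abelianCount (p ^ u.factorization p) *
        ((abelianCount (p ^ (u.factorization p + k)) : ℂ) * χ ((p : ZMod r) ^ k) *
          (p : ℂ) ^ (-(k : ℂ) * z)) := by
  have h : (abelianCount (u * p ^ k) : ℂ) * abelianCount (p ^ u.factorization p) =
      abelianCount u * abelianCount (p ^ (u.factorization p + k)) := by
    exact_mod_cast abelianCount_mul_prime_pow hu hp k
  have h0 : (abelianCount (p ^ u.factorization p) : ℂ) ≠ 0 :=
    Nat.cast_ne_zero.2 (abelianCount_pos _).ne'
  rw [natCast_pow_cpow_neg, Nat.cast_pow, eq_div_of_mul_eq h0 h]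
  ring

lemma summable_norm_local_factor {u : ℕ} (hu : 0 < u) {r : ℕ} (χ : DirichletCharacter ℂ r) {z : ℂ}
    (hz : 1 < z.re) {p : ℕ} (hp : p.Prime) :
    Summable fun α : ℕ =>
      ‖(abelianCount (p ^ (u.factorization p + α)) : ℂ) * χ ((p : ZMod r) ^ α) *
        (p : ℂ) ^ (-(α : ℂ) * z)‖ := by
  have h := (summable_norm_abelianCount_twisted hu χ hz).comp_injective
    (Nat.pow_right_injective hp.two_le)
  have h0 (n : ℕ) : (abelianCount n : ℂ) ≠ 0 := Nat.cast_ne_zero.2 (abelianCount_pos _).ne'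
  refine (summable_mul_left_iff
    (norm_ne_zero_iff.2 (div_ne_zero (h0 u) (h0 (p ^ u.factorization p))))).1 (h.congr fun k => ?_)
  rw [← norm_mul, ← abelianCount_twisted_prime_pow hu.ne' χ z hp]
  rfl

lemma natCast_zero_cpow_neg {z : ℂ} (hz : 1 < z.re) : ((0 : ℕ) : ℂ) ^ (-z) = 0 := by
  rw [Nat.cast_zero, Complex.zero_cpow]
  rintro h
  norm_num [neg_eq_zero.1 h] at hz

lemma abelianCount_twisted_mul {u : ℕ} (hu : u ≠ 0) {r : ℕ} (χ : DirichletCharacter ℂ r) {z : ℂ}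
    (hz : 1 < z.re) {m n : ℕ} (h : m.Coprime n) :
    ((abelianCount (u * (m * n)) : ℂ) * χ ((m * n : ℕ) : ZMod r) * ((m * n : ℕ) : ℂ) ^ (-z)) *
        abelianCount u =
      ((abelianCount (u * m) : ℂ) * χ (m : ZMod r) * (m : ℂ) ^ (-z)) *
        ((abelianCount (u * n) : ℂ) * χ (n : ZMod r) * (n : ℂ) ^ (-z)) := by
  rcases eq_or_ne m 0 with rfl | hm
  · simp only [zero_mul, natCast_zero_cpow_neg hz, mul_zero]
  rcases eq_or_ne n 0 with rfl | hn
  · simp only [zero_mul, natCast_zero_cpow_neg hz, mul_zero]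
  have ha : (abelianCount (u * (m * n)) : ℂ) * abelianCount u =
      abelianCount (u * m) * abelianCount (u * n) := by
    exact_mod_cast abelianCount_mul_mul_of_coprime hu hm hn h
  rw [Nat.cast_mul, map_mul, Nat.cast_mul, Complex.natCast_mul_natCast_cpow]
  linear_combination χ (m : ZMod r) * χ (n : ZMod r) * (m : ℂ) ^ (-z) * (n : ℂ) ^ (-z) * ha

lemma hasProd_local_factors_div {u : ℕ} (hu : 0 < u) {r : ℕ} (χ : DirichletCharacter ℂ r) {z : ℂ}
    (hz : 1 < z.re) :
    HasProd (fun p : Nat.Primes => (∑' α : ℕ,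
        (abelianCount ((p : ℕ) ^ (u.factorization p + α)) : ℂ) *
          χ (((p : ℕ) : ZMod r) ^ α) * ((p : ℕ) : ℂ) ^ (-(α : ℂ) * z)) /
        abelianCount ((p : ℕ) ^ u.factorization p))
      ((∑' n : ℕ, (abelianCount (u * n) : ℂ) * χ (n : ZMod r) * (n : ℂ) ^ (-z)) /
        abelianCount u) := by
  have h0 : (abelianCount u : ℂ) ≠ 0 := Nat.cast_ne_zero.2 (abelianCount_pos _).ne'
  have hE := EulerProduct.eulerProduct_hasProd
    (f := fun n : ℕ => (abelianCount (u * n) : ℂ) * χ (n : ZMod r) * (n : ℂ) ^ (-z) /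
      abelianCount u) (by simp [h0])
    (fun {m n} h => by
      rw [div_mul_div_comm, ← abelianCount_twisted_mul hu.ne' χ hz h, mul_div_mul_right _ _ h0])
    (by simpa [norm_div] using (summable_norm_abelianCount_twisted hu χ hz).div_const _)
    (by simp only [natCast_zero_cpow_neg hz, mul_zero, zero_div])
  rw [tsum_div_const] at hE
  convert hE using 2 with p
  rw [← tsum_div_const]
  refine tsum_congr fun k => ?_
  rw [abelianCount_twisted_prime_pow hu.ne' χ z p.prop]
  field_simp

lemma multipliable_local_factors_coprime {u : ℕ} {r : ℕ} (χ : DirichletCharacter ℂ r)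
    {z : ℂ} (hz : 1 < z.re) :
    Multipliable fun p : {p : ℕ // p.Prime ∧ ¬ p ∣ u} =>
      ∑' α : ℕ, (abelianCount ((p : ℕ) ^ α) : ℂ) * χ (((p : ℕ) : ZMod r) ^ α) *
        ((p : ℕ) : ℂ) ^ (-(α : ℂ) * z) := by
  set t : ℕ → ℂ := fun n => (abelianCount n : ℂ) * χ (n : ZMod r) * (n : ℂ) ^ (-z) with ht
  have hmul {m n : ℕ} (h : m.Coprime n) : t (m * n) = t m * t n := by
    simpa only [one_mul, abelianCount_one, Nat.cast_one, mul_one] using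
      abelianCount_twisted_mul one_ne_zero χ hz h
  have hsum : Summable fun n => ‖t n‖ := by
    simpa only [one_mul] using summable_norm_abelianCount_twisted one_pos χ hz
  have hE := (EulerProduct.eulerProduct_hasProd_mulIndicator
    (f := fun n : ℕ => if n.Coprime u then t n else 0) (by simp [ht, abelianCount_one])
    (fun {m n} h => by
      simp only [Nat.coprime_mul_iff_left]
      split_ifs <;> first | exact hmul h | simp_all)
    (hsum.of_nonneg_of_le (fun _ => norm_nonneg _) fun n => by split_ifs <;> simp)
    (by simp only [ht, natCast_zero_cpow_neg hz, mul_zero, ite_self])).multipliable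
  change Multipliable ((fun p : ℕ => ∑' α : ℕ, (abelianCount (p ^ α) : ℂ) *
    χ ((p : ZMod r) ^ α) * (p : ℂ) ^ (-(α : ℂ) * z)) ∘
      ((↑) : {p : ℕ | p.Prime ∧ ¬ p ∣ u} → ℕ))
  rw [multipliable_subtype_iff_mulIndicator]
  convert hE using 1
  ext p
  by_cases hp : p.Prime
  · by_cases hpu : p ∣ u
    · rw [Set.mulIndicator_of_notMem (by simp [hpu]), Set.mulIndicator_of_mem (by exact hp),
        tsum_eq_single 0]
      · simp [ht, abelianCount_one]
      · intro k hk
        rw [if_neg]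
        rw [Nat.coprime_pow_left_iff (Nat.pos_of_ne_zero hk), hp.coprime_iff_not_dvd]
        simpa using hpu
    · rw [Set.mulIndicator_of_mem (by exact ⟨hp, hpu⟩), Set.mulIndicator_of_mem (by exact hp)]
      refine tsum_congr fun k => ?_
      rw [if_pos (((hp.coprime_iff_not_dvd).2 hpu).pow_left k)]
      simp only [ht]
      rw [natCast_pow_cpow_neg, Nat.cast_pow]
  · rw [Set.mulIndicator_of_notMem (by simp [hp]), Set.mulIndicator_of_notMem (by exact hp)]

theorem eulerProduct_abelianCount_twisted (u : ℕ) (hu : 0 < u) (r₁ : ℕ) (hr₁ : 0 < r₁)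
    (χ : DirichletCharacter ℂ r₁) (z : ℂ) (hz : 1 < z.re) :
    -- the Dirichlet series converges absolutely
    (Summable fun n : ℕ =>
      ‖(abelianCount (u * n) : ℂ) * χ (n : ZMod r₁) * (n : ℂ) ^ (-z)‖) ∧
    -- the inner series at primes not dividing `u` converge absolutely
    (∀ p : ℕ, p.Prime → ¬ p ∣ u →
      Summable fun α : ℕ =>
        ‖(abelianCount (p ^ α) : ℂ) * χ ((p : ZMod r₁) ^ α) * (p : ℂ) ^ (-(α : ℂ) * z)‖) ∧
    -- the inner series at primes dividing `u` converge absolutely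
    (∀ p : ℕ, p.Prime → p ∣ u →
      Summable fun α : ℕ =>
        ‖(abelianCount (p ^ (u.factorization p + α)) : ℂ) * χ ((p : ZMod r₁) ^ α) *
          (p : ℂ) ^ (-(α : ℂ) * z)‖) ∧
    -- the product over primes not dividing `u` converges
    (Multipliable fun p : {p : ℕ // p.Prime ∧ ¬ p ∣ u} =>
      ∑' α : ℕ, (abelianCount ((p : ℕ) ^ α) : ℂ) * χ (((p : ℕ) : ZMod r₁) ^ α) *
        ((p : ℕ) : ℂ) ^ (-(α : ℂ) * z)) ∧
    -- the product over primes dividing `u` converges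
    (Multipliable fun p : {p : ℕ // p.Prime ∧ p ∣ u} =>
      ∑' α : ℕ, (abelianCount ((p : ℕ) ^ (u.factorization (p : ℕ) + α)) : ℂ) *
        χ (((p : ℕ) : ZMod r₁) ^ α) * ((p : ℕ) : ℂ) ^ (-(α : ℂ) * z)) ∧
    -- the Dirichlet series equals the Euler product
    (∑' n : ℕ, (abelianCount (u * n) : ℂ) * χ (n : ZMod r₁) * (n : ℂ) ^ (-z)) =
      (∏' p : {p : ℕ // p.Prime ∧ ¬ p ∣ u},
        ∑' α : ℕ, (abelianCount ((p : ℕ) ^ α) : ℂ) * χ (((p : ℕ) : ZMod r₁) ^ α) *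
          ((p : ℕ) : ℂ) ^ (-(α : ℂ) * z)) *
      (∏' p : {p : ℕ // p.Prime ∧ p ∣ u},
        ∑' α : ℕ, (abelianCount ((p : ℕ) ^ (u.factorization (p : ℕ) + α)) : ℂ) *
          χ (((p : ℕ) : ZMod r₁) ^ α) * ((p : ℕ) : ℂ) ^ (-(α : ℂ) * z)) := by
  have hfac {p : ℕ} (h : ¬ p ∣ u) : u.factorization p = 0 :=
    Nat.factorization_eq_zero_of_not_dvd h
  have hm := multipliable_local_factors_coprime (u := u) χ hz
  have : Finite {p : ℕ // p.Prime ∧ p ∣ u} :=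
    Set.Finite.to_subtype (s := {p : ℕ | p.Prime ∧ p ∣ u})
      ((Set.finite_le_nat u).subset fun p hp => Nat.le_of_dvd hu hp.2)
  have := Fintype.ofFinite {p : ℕ // p.Prime ∧ p ∣ u}
  refine ⟨summable_norm_abelianCount_twisted hu χ hz, fun p hp hpu => ?_,
    fun p hp _ => summable_norm_local_factor hu χ hz hp, hm, (hasProd_fintype _).multipliable, ?_⟩
  · simpa [hfac hpu] using summable_norm_local_factor hu χ hz hp
  set G : ℕ → ℂ := fun p => ∑' α : ℕ, (abelianCount (p ^ (u.factorization p + α)) : ℂ) *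
    χ ((p : ZMod r₁) ^ α) * (p : ℂ) ^ (-(α : ℂ) * z) with hG
  set c : ℕ → ℂ := fun p => abelianCount (p ^ u.factorization p) with hc
  have hGcop (p : {p : ℕ // p.Prime ∧ ¬ p ∣ u}) :
      (∑' α : ℕ, (abelianCount ((p : ℕ) ^ α) : ℂ) * χ (((p : ℕ) : ZMod r₁) ^ α) *
        ((p : ℕ) : ℂ) ^ (-(α : ℂ) * z)) = G p / c p := by
    simp [hG, hc, hfac p.2.2, abelianCount_one]
  have hcu : ∏ p : {p : ℕ // p.Prime ∧ p ∣ u}, c p = abelianCount u := by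
    rw [abelianCount_eq_prod subset_rfl, Nat.cast_prod,
      Finset.prod_subtype u.primeFactors (p := fun p => p.Prime ∧ p ∣ u) (by simp [hu.ne'])]
    exact Fintype.prod_congr _ _ fun p => by simp only [hc, abelianCount_prime_pow p.2.1]
  simp only [hGcop] at hm ⊢
  have hdisj : Disjoint {p : ℕ | p.Prime ∧ ¬ p ∣ u} {p : ℕ | p.Prime ∧ p ∣ u} :=
    Set.disjoint_left.2 fun p h1 h2 => h1.2 h2.2
  have hunion : {p : ℕ | p.Prime ∧ ¬ p ∣ u} ∪ {p : ℕ | p.Prime ∧ p ∣ u} = {p : ℕ | p.Prime} := by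
    ext p
    simp only [Set.mem_union, Set.mem_ofPred_eq]
    tauto
  have hprod : HasProd ((fun p => G p / c p) ∘
      ((↑) : ({p : ℕ | p.Prime ∧ ¬ p ∣ u} ∪ {p : ℕ | p.Prime ∧ p ∣ u} : Set ℕ) → ℕ)) _ :=
    HasProd.mul_disjoint hdisj hm.hasProd
      (hasProd_fintype fun p : {p : ℕ // p.Prime ∧ p ∣ u} => G p / c p)
  rw [hunion] at hprod
  have hE := hprod.unique (hasProd_local_factors_div hu χ hz)
  rw [Finset.prod_div_distrib, hcu, ← mul_div_assoc,
    div_left_inj' (Nat.cast_ne_zero.2 (abelianCount_pos u).ne')] at hE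
  rw [← hE, tprod_fintype (β := {p : ℕ // p.Prime ∧ p ∣ u})]
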